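/- arXiv:2402.02954 — 4 statements merged into one kernel-verified Lean document; each statement's English description precedes it below -/
import Mathlib

section
/- The maximum of the value V(a) over all decision-rule profiles equals the aggregated backward-recursion value: max over all tuples (a_1 : O_1 → U_1, …, a_n : O_n → U_n) of ∑_{x∈X} ∑_{o∈O_n} w(x,o)·f(x, o, a_1(π_1(o)), …, a_n(π_n(o))) = ∑_{q∈O_1} F_1(q). (Thus the single-stage subgame of the hierarchical-information-sharing Dec-POMDP has the same optimal value as its perfect-information extensive-form game solved by backward induction, one player at a time.) -/
section BackwardRecursion

variable {O U : ℕ → Type} {h : (i : ℕ) → O (i + 1) → O i} {pr : (j i : ℕ) → O i → O j}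

/-- The action tuple reached at a history when each player `i` uses the policy `b i`, which may
depend on the actions of the players before `i`. -/
def greedyActions (h : (i : ℕ) → O (i + 1) → O i) (b : (i : ℕ) → O i → ((j : ℕ) → U j) → U i)
    (u₀ : (j : ℕ) → U j) : (i : ℕ) → O i → (j : ℕ) → U j
  | 0, _ => u₀
  | i + 1, o =>
    Function.update (greedyActions h b u₀ i (h i o)) i
      (b i (h i o) (greedyActions h b u₀ i (h i o)))

theorem greedyActions_eq
    (hprrefl : ∀ i, pr i i = id)
    (hprstep : ∀ j i, j ≤ i → ∀ o : O (i + 1), pr j (i + 1) o = pr j i (h i o))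
    (b : (i : ℕ) → O i → ((j : ℕ) → U j) → U i) (u₀ : (j : ℕ) → U j)
    (i : ℕ) (o : O i) (j : ℕ) (hj : j < i) :
    greedyActions h b u₀ i o j = b j (pr j i o) (greedyActions h b u₀ j (pr j i o)) := by
  induction i with
  | zero => exact absurd hj j.not_lt_zero
  | succ i ih =>
    rw [greedyActions, hprstep j i (Nat.lt_succ_iff.mp hj)]
    rcases (Nat.lt_succ_iff.mp hj).eq_or_lt with rfl | hj
    · simp [hprrefl]
    · rw [Function.update_of_ne hj.ne, ih _ hj]

variable [∀ i, Fintype (O i)] [∀ i, DecidableEq (O i)] [∀ i, Fintype (U i)]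
  [∀ i, Nonempty (U i)] {m : ℕ} {W : O m → ((j : ℕ) → U j) → ℝ}
  {F : (i : ℕ) → O i → ((j : ℕ) → U j) → ℝ}

/-- The backward-recursion value of player `i` depends only on the actions of players `j < i`. -/
theorem backwardRecursion_congr
    (hW : ∀ o u u', (∀ j, j ≤ m → u j = u' j) → W o u = W o u')
    (hFtop : ∀ o u, F m o u = Finset.univ.sup' Finset.univ_nonempty fun v : U m =>
      W o (Function.update u m v))
    (hFstep : ∀ i, i < m → ∀ (q : O i) (u : (j : ℕ) → U j),
      F i q u = Finset.univ.sup' Finset.univ_nonempty fun v : U i =>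
        ∑ o' ∈ Finset.univ.filter (fun o' : O (i + 1) => h i o' = q),
          F (i + 1) o' (Function.update u i v))
    {i : ℕ} (hi : i ≤ m) (q : O i) (u u' : (j : ℕ) → U j) (huu : ∀ j, j < i → u j = u' j) :
    F i q u = F i q u' := by
  have update_agree : ∀ (k : ℕ) (u u' : (j : ℕ) → U j) (v : U k), (∀ j, j < k → u j = u' j) →
      ∀ j, j ≤ k → Function.update u k v j = Function.update u' k v j := by
    intro k u u' v huu j hj
    rcases hj.eq_or_lt with rfl | hj
    · simp
    · simpa [hj.ne] using huu j hj
  induction hi using Nat.decreasingInduction generalizing u u' with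
  | self =>
    rw [hFtop, hFtop]
    congr 1
    funext v
    exact hW _ _ _ (update_agree m u u' v huu)
  | of_succ i hi ih =>
    rw [hFstep i hi, hFstep i hi]
    congr 1
    funext v
    exact Finset.sum_congr rfl fun o' _ =>
      ih o' _ _ fun j hj => update_agree i u u' v huu j (Nat.lt_succ_iff.mp hj)

theorem value_le_backwardRecursion
    (hprstep : ∀ j i, j ≤ i → ∀ o : O (i + 1), pr j (i + 1) o = pr j i (h i o))
    (hW : ∀ o u u', (∀ j, j ≤ m → u j = u' j) → W o u = W o u')
    (hFtop : ∀ o u, F m o u = Finset.univ.sup' Finset.univ_nonempty fun v : U m =>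
      W o (Function.update u m v))
    (hFstep : ∀ i, i < m → ∀ (q : O i) (u : (j : ℕ) → U j),
      F i q u = Finset.univ.sup' Finset.univ_nonempty fun v : U i =>
        ∑ o' ∈ Finset.univ.filter (fun o' : O (i + 1) => h i o' = q),
          F (i + 1) o' (Function.update u i v))
    (u₀ : (j : ℕ) → U j) (a : (i : ℕ) → O i → U i) :
    ∑ o, W o (fun j => a j (pr j m o)) ≤ ∑ q, F 0 q u₀ := by
  have value_le : ∀ i, i ≤ m →
      ∑ o, W o (fun j => a j (pr j m o)) ≤ ∑ q, F i q (fun j => a j (pr j i q)) := by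
    intro i hi
    induction hi using Nat.decreasingInduction with
    | self =>
      refine Finset.sum_le_sum fun o _ => ?_
      rw [hFtop]
      refine le_trans (le_of_eq ?_) (Finset.le_sup' _ (Finset.mem_univ (a m (pr m m o))))
      rw [Function.update_eq_self m (fun j => a j (pr j m o))]
    | of_succ i hi ih =>
      refine ih.trans ?_
      rw [← Finset.sum_fiberwise Finset.univ (h i)]
      refine Finset.sum_le_sum fun q _ => ?_
      rw [hFstep i hi]
      refine le_trans (le_of_eq ?_) (Finset.le_sup' _ (Finset.mem_univ (a i (pr i i q))))
      rw [Function.update_eq_self i (fun j => a j (pr j i q))]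
      refine Finset.sum_congr rfl fun o' ho' => ?_
      refine backwardRecursion_congr hW hFtop hFstep hi o' _ _ fun j hj => ?_
      rw [hprstep j i (Nat.lt_succ_iff.mp hj), (Finset.mem_filter.mp ho').2]
  refine (value_le 0 m.zero_le).trans (le_of_eq ?_)
  exact Finset.sum_congr rfl fun q _ =>
    backwardRecursion_congr hW hFtop hFstep m.zero_le q _ _ fun j hj => absurd hj j.not_lt_zero

theorem exists_value_eq_backwardRecursion
    (hprrefl : ∀ i, pr i i = id)
    (hprstep : ∀ j i, j ≤ i → ∀ o : O (i + 1), pr j (i + 1) o = pr j i (h i o))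
    (hW : ∀ o u u', (∀ j, j ≤ m → u j = u' j) → W o u = W o u')
    (hFtop : ∀ o u, F m o u = Finset.univ.sup' Finset.univ_nonempty fun v : U m =>
      W o (Function.update u m v))
    (hFstep : ∀ i, i < m → ∀ (q : O i) (u : (j : ℕ) → U j),
      F i q u = Finset.univ.sup' Finset.univ_nonempty fun v : U i =>
        ∑ o' ∈ Finset.univ.filter (fun o' : O (i + 1) => h i o' = q),
          F (i + 1) o' (Function.update u i v))
    (u₀ : (j : ℕ) → U j) :
    ∃ a : (i : ℕ) → O i → U i, ∑ q, F 0 q u₀ = ∑ o, W o (fun j => a j (pr j m o)) := by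
  have exists_policy : ∀ (i : ℕ) (q : O i) (u : (j : ℕ) → U j), ∃ v : U i,
      (i < m → F i q u = ∑ o' ∈ Finset.univ.filter (fun o' : O (i + 1) => h i o' = q),
        F (i + 1) o' (Function.update u i v)) ∧
      ∀ e : i = m, F i q u = W (e ▸ q) (Function.update u i v) := by
    intro i q u
    rcases lt_trichotomy i m with hi | rfl | hi
    · obtain ⟨v, -, hv⟩ := Finset.exists_mem_eq_sup' (Finset.univ_nonempty (α := U i))
        fun v => ∑ o' ∈ Finset.univ.filter (fun o' : O (i + 1) => h i o' = q),
          F (i + 1) o' (Function.update u i v)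
      exact ⟨v, fun _ => (hFstep i hi q u).trans hv, fun e => absurd e hi.ne⟩
    · obtain ⟨v, -, hv⟩ := Finset.exists_mem_eq_sup' (Finset.univ_nonempty (α := U i))
        fun v => W q (Function.update u i v)
      exact ⟨v, fun hi => absurd hi (lt_irrefl _), fun _ => (hFtop q u).trans hv⟩
    · exact ⟨Classical.arbitrary _, fun hi' => absurd hi' hi.not_gt, fun e => absurd e hi.ne'⟩
  choose b hbstep hbtop using exists_policy
  refine ⟨fun i q => b i q (greedyActions h b u₀ i q), ?_⟩
  have sum_eq : ∀ i, i ≤ m → ∑ q, F 0 q u₀ = ∑ q, F i q (greedyActions h b u₀ i q) := by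
    intro i
    induction i with
    | zero => exact fun _ => rfl
    | succ i ih =>
      intro hi
      rw [ih (Nat.le_of_succ_le hi), ← Finset.sum_fiberwise Finset.univ (h i)]
      refine Finset.sum_congr rfl fun q _ => ?_
      rw [hbstep i q _ hi]
      refine Finset.sum_congr rfl fun o' ho' => ?_
      rw [greedyActions, (Finset.mem_filter.mp ho').2]
  rw [sum_eq m le_rfl]
  refine Finset.sum_congr rfl fun o _ => ?_
  rw [hbtop m o _ rfl]
  refine hW _ _ _ fun j hj => ?_
  rcases hj.eq_or_lt with rfl | hj
  · simp [hprrefl]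
  · rw [Function.update_of_ne hj.ne, greedyActions_eq hprrefl hprstep b u₀ m o j hj]

end BackwardRecursion


/- Players are indexed `0, …, n-1`: player `0` is at the bottom of the hierarchy
(the paper's player `1`) and player `n-1` is at the top (the paper's player `n`).
`h i : O (i+1) → O i` maps a player's history to its subordinate's history, and
`pr j i : O i → O j` is the composite `π_{j,i}` (characterized by `hprrefl`/`hprstep`).
`F i` is the backward-recursion value for player `i`; it is characterized on the
coordinates `j < i` of its action-tuple argument by `hFtop`/`hFstep` together with `hf`,
which says that `f` only depends on the actions of the `n` players. -/
theorem stmt0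
    (n : ℕ) (hn : 1 ≤ n)
    (O : ℕ → Type) [∀ i, Fintype (O i)] [∀ i, Nonempty (O i)] [∀ i, DecidableEq (O i)]
    (U : ℕ → Type) [∀ i, Fintype (U i)] [∀ i, Nonempty (U i)]
    (X : Type) [Fintype X]
    (h : (i : ℕ) → O (i + 1) → O i)
    (pr : (j i : ℕ) → O i → O j)
    (hprrefl : ∀ i, pr i i = id)
    (hprstep : ∀ j i, j ≤ i → ∀ o : O (i + 1), pr j (i + 1) o = pr j i (h i o))
    (w : X → O (n - 1) → ℝ)
    (f : X → O (n - 1) → ((j : ℕ) → U j) → ℝ)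
    (hf : ∀ x o u u', (∀ j, j < n → u j = u' j) → f x o u = f x o u')
    (F : (i : ℕ) → O i → ((j : ℕ) → U j) → ℝ)
    (hFtop : ∀ (o : O (n - 1)) (u : (j : ℕ) → U j),
      F (n - 1) o u = Finset.univ.sup' Finset.univ_nonempty fun v : U (n - 1) =>
        ∑ x, w x o * f x o (Function.update u (n - 1) v))
    (hFstep : ∀ i, i < n - 1 → ∀ (q : O i) (u : (j : ℕ) → U j),
      F i q u = Finset.univ.sup' Finset.univ_nonempty fun v : U i =>
        ∑ o' ∈ Finset.univ.filter (fun o' : O (i + 1) => h i o' = q),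
          F (i + 1) o' (Function.update u i v))
    (u₀ : (j : ℕ) → U j) :
    IsGreatest
      {val : ℝ | ∃ a : (i : ℕ) → O i → U i,
        val = ∑ x, ∑ o : O (n - 1), w x o * f x o (fun j => a j (pr j (n - 1) o))}
      (∑ q, F 0 q u₀) := by
  have hW : ∀ (o : O (n - 1)) (u u' : (j : ℕ) → U j), (∀ j, j ≤ n - 1 → u j = u' j) →
      ∑ x, w x o * f x o u = ∑ x, w x o * f x o u' := fun o u u' huu =>
    Finset.sum_congr rfl fun x _ => by rw [hf x o u u' fun j hj => huu j (by omega)]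
  constructor
  · obtain ⟨a, ha⟩ := exists_value_eq_backwardRecursion
      (W := fun o u => ∑ x, w x o * f x o u) hprrefl hprstep hW hFtop hFstep u₀
    exact ⟨a, ha.trans Finset.sum_comm⟩
  · rintro _ ⟨a, rfl⟩
    rw [Finset.sum_comm]
    exact value_le_backwardRecursion
      (W := fun o u => ∑ x, w x o * f x o u) hprstep hW hFtop hFstep u₀ a
end

section
/- Every greedy decision-rule profile is optimal: if (a*_1,…,a*_n) is a profile such that for each q ∈ O_1 the action a*_1(q) attains the maximum defining F_1(q), and for each 1 < i ≤ n and each o ∈ O_i the action a*_i(o) attains the maximum defining F_i(o, a*_1(π_{1,i}(o)), …, a*_{i−1}(π_{i−1,i}(o))), then V(a*) = ∑_{q∈O_1} F_1(q) = max over all decision-rule profiles a of V(a). (Thus a forward pass selecting, for each player in hierarchy order and each of its private histories independently, an argmax of the backward-recursion values yields an optimal joint decision rule.) -/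
section BackwardRecursion

variable {N : ℕ} {O : ℕ → Type} {U : ℕ → Type} {X : Type}

/-- The backward-recursion value of player `i` depends only on the actions of the players
below `i`. -/
theorem backwardValue_congr [∀ i, Fintype (O i)] [∀ i, DecidableEq (O i)]
    [∀ i, Fintype (U i)] [∀ i, Nonempty (U i)] [Fintype X]
    {h : (i : ℕ) → O (i + 1) → O i}
    {w : X → O N → ℝ} {f : X → O N → ((j : ℕ) → U j) → ℝ}
    (hf : ∀ x o u u', (∀ j, j ≤ N → u j = u' j) → f x o u = f x o u')
    {F : (i : ℕ) → O i → ((j : ℕ) → U j) → ℝ}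
    (hFtop : ∀ (o : O N) (u : (j : ℕ) → U j),
      F N o u = Finset.univ.sup' Finset.univ_nonempty fun v : U N =>
        ∑ x, w x o * f x o (Function.update u N v))
    (hFstep : ∀ i, i < N → ∀ (q : O i) (u : (j : ℕ) → U j),
      F i q u = Finset.univ.sup' Finset.univ_nonempty fun v : U i =>
        ∑ o' ∈ Finset.univ.filter (fun o' : O (i + 1) => h i o' = q),
          F (i + 1) o' (Function.update u i v))
    {i : ℕ} (hi : i ≤ N) :
    ∀ (q : O i) (u u' : (j : ℕ) → U j), (∀ j, j < i → u j = u' j) → F i q u = F i q u' := by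
  have update_congr : ∀ (i : ℕ) (u u' : (j : ℕ) → U j), (∀ j, j < i → u j = u' j) →
      ∀ v j, j ≤ i → Function.update u i v j = Function.update u' i v j := by
    intro i u u' huu v j hj
    rcases hj.eq_or_lt with rfl | hj
    · simp
    · simpa [Function.update_of_ne hj.ne] using huu j hj
  induction hi using Nat.decreasingInduction with
  | self =>
    intro q u u' huu
    rw [hFtop, hFtop]
    congr 1
    funext v
    exact Finset.sum_congr rfl fun x _ => by
      rw [hf x q _ _ (update_congr _ _ _ huu v)]
  | of_succ i hi ih =>
    intro q u u' huu
    rw [hFstep i hi, hFstep i hi]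
    congr 1
    funext v
    exact Finset.sum_congr rfl fun o' _ =>
      ih o' _ _ fun j hj => update_congr _ _ _ huu v j (Nat.lt_succ_iff.mp hj)

/-- The tuple of actions that a profile induces at a history of player `i` already has the action
taken at that history as its `i`-th entry. -/
theorem update_profile_eq_self {pr : (j i : ℕ) → O i → O j}
    (hprrefl : ∀ i, pr i i = id)
    (a : (i : ℕ) → O i → U i) (i : ℕ) (q : O i) :
    Function.update (fun j => a j (pr j i q)) i (a i q) = fun j => a j (pr j i q) := by
  rw [Function.update_eq_self_iff, hprrefl, id]

/-- Summing the values of the next player over the fibres of `h i` amounts to summing over all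
histories of the next player. -/
theorem sum_fiber_backwardValue [∀ i, Fintype (O i)] [∀ i, DecidableEq (O i)]
    {h : (i : ℕ) → O (i + 1) → O i} {pr : (j i : ℕ) → O i → O j}
    (hprrefl : ∀ i, pr i i = id)
    (hprstep : ∀ j i, j ≤ i → ∀ o : O (i + 1), pr j (i + 1) o = pr j i (h i o))
    {F : (i : ℕ) → O i → ((j : ℕ) → U j) → ℝ} {i : ℕ}
    (hF : ∀ (q : O (i + 1)) (u u' : (j : ℕ) → U j), (∀ j, j < i + 1 → u j = u' j) →
      F (i + 1) q u = F (i + 1) q u')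
    (a : (i : ℕ) → O i → U i) :
    ∑ q, ∑ o' ∈ Finset.univ.filter (fun o' : O (i + 1) => h i o' = q),
        F (i + 1) o' (Function.update (fun j => a j (pr j i q)) i (a i q)) =
      ∑ o', F (i + 1) o' (fun j => a j (pr j (i + 1) o')) := by
  rw [← Finset.sum_fiberwise Finset.univ (h i)]
  refine Finset.sum_congr rfl fun q _ => Finset.sum_congr rfl fun o' ho' => ?_
  obtain rfl : h i o' = q := (Finset.mem_filter.mp ho').2
  rw [update_profile_eq_self hprrefl]
  exact hF o' _ _ fun j hj => by rw [hprstep j i (Nat.lt_succ_iff.mp hj)]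

end BackwardRecursion

/- Players are indexed `0, …, n-1`: player `0` is at the bottom of the hierarchy
(the paper's player `1`) and player `n-1` is at the top (the paper's player `n`).
`h i : O (i+1) → O i` maps a player's history to its subordinate's history, and
`pr j i : O i → O j` is the composite `π_{j,i}` (characterized by `hprrefl`/`hprstep`).
`F i` is the backward-recursion value for player `i` (`hFtop`/`hFstep`), and `astar` is
a greedy profile: at every history of every player, its action attains the maximum
defining `F` there (`hgreedytop`/`hgreedystep`, in which the tuple argument
`fun j => astar j (pr j i q)` records the greedy actions of the subordinates).
Conclusion: the greedy profile attains `∑_q F_0(q)`, which is the maximum value. -/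
theorem stmt1
    (n : ℕ) (hn : 1 ≤ n)
    (O : ℕ → Type) [∀ i, Fintype (O i)] [∀ i, Nonempty (O i)] [∀ i, DecidableEq (O i)]
    (U : ℕ → Type) [∀ i, Fintype (U i)] [∀ i, Nonempty (U i)]
    (X : Type) [Fintype X]
    (h : (i : ℕ) → O (i + 1) → O i)
    (pr : (j i : ℕ) → O i → O j)
    (hprrefl : ∀ i, pr i i = id)
    (hprstep : ∀ j i, j ≤ i → ∀ o : O (i + 1), pr j (i + 1) o = pr j i (h i o))
    (w : X → O (n - 1) → ℝ)
    (f : X → O (n - 1) → ((j : ℕ) → U j) → ℝ)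
    (hf : ∀ x o u u', (∀ j, j < n → u j = u' j) → f x o u = f x o u')
    (F : (i : ℕ) → O i → ((j : ℕ) → U j) → ℝ)
    (hFtop : ∀ (o : O (n - 1)) (u : (j : ℕ) → U j),
      F (n - 1) o u = Finset.univ.sup' Finset.univ_nonempty fun v : U (n - 1) =>
        ∑ x, w x o * f x o (Function.update u (n - 1) v))
    (hFstep : ∀ i, i < n - 1 → ∀ (q : O i) (u : (j : ℕ) → U j),
      F i q u = Finset.univ.sup' Finset.univ_nonempty fun v : U i =>
        ∑ o' ∈ Finset.univ.filter (fun o' : O (i + 1) => h i o' = q),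
          F (i + 1) o' (Function.update u i v))
    (u₀ : (j : ℕ) → U j)
    (astar : (i : ℕ) → O i → U i)
    (hgreedytop : ∀ o : O (n - 1),
      F (n - 1) o (fun j => astar j (pr j (n - 1) o)) =
        ∑ x, w x o * f x o
          (Function.update (fun j => astar j (pr j (n - 1) o)) (n - 1)
            (astar (n - 1) o)))
    (hgreedystep : ∀ i, i < n - 1 → ∀ q : O i,
      F i q (fun j => astar j (pr j i q)) =
        ∑ o' ∈ Finset.univ.filter (fun o' : O (i + 1) => h i o' = q),
          F (i + 1) o'
            (Function.update (fun j => astar j (pr j i q)) i (astar i q))) :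
    (∑ x, ∑ o : O (n - 1), w x o * f x o (fun j => astar j (pr j (n - 1) o))) =
        ∑ q, F 0 q u₀ ∧
      IsGreatest
        {val : ℝ | ∃ a : (i : ℕ) → O i → U i,
          val = ∑ x, ∑ o : O (n - 1), w x o * f x o (fun j => a j (pr j (n - 1) o))}
        (∑ x, ∑ o : O (n - 1), w x o * f x o (fun j => astar j (pr j (n - 1) o))) := by
  have hcongr {i : ℕ} (hi : i ≤ n - 1) :=
    backwardValue_congr (fun x o u u' huu => hf x o u u' fun j hj => huu j (by omega))
      hFtop hFstep hi
  have value_le (a : (i : ℕ) → O i → U i) :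
      ∑ x, ∑ o : O (n - 1), w x o * f x o (fun j => a j (pr j (n - 1) o)) ≤ ∑ q, F 0 q u₀ := by
    have le_zero : ∀ i, i ≤ n - 1 →
        ∑ q, F i q (fun j => a j (pr j i q)) ≤ ∑ q, F 0 q u₀ := by
      intro i
      induction i with
      | zero =>
        exact fun hi => (Finset.sum_congr rfl fun q _ => hcongr hi q _ _ (by simp)).le
      | succ i ih =>
        intro hi
        refine le_trans ?_ (ih (by omega))
        rw [← sum_fiber_backwardValue hprrefl hprstep (hcongr hi) a]
        refine Finset.sum_le_sum fun q _ => ?_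
        rw [hFstep i hi]
        exact Finset.le_sup' (fun v : U i =>
          ∑ o' ∈ Finset.univ.filter (fun o' : O (i + 1) => h i o' = q),
            F (i + 1) o' (Function.update (fun j => a j (pr j i q)) i v)) (Finset.mem_univ _)
    refine le_trans ?_ (le_zero (n - 1) le_rfl)
    rw [Finset.sum_comm]
    refine Finset.sum_le_sum fun o _ => ?_
    rw [hFtop]
    refine le_trans (le_of_eq ?_) (Finset.le_sup' (fun v : U (n - 1) =>
      ∑ x, w x o * f x o (Function.update (fun j => a j (pr j (n - 1) o)) (n - 1) v))
      (Finset.mem_univ (a (n - 1) o)))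
    rw [update_profile_eq_self hprrefl]
  have value_greedy :
      ∑ x, ∑ o : O (n - 1), w x o * f x o (fun j => astar j (pr j (n - 1) o)) = ∑ q, F 0 q u₀ := by
    have eq_zero : ∀ i, i ≤ n - 1 →
        ∑ q, F i q (fun j => astar j (pr j i q)) = ∑ q, F 0 q u₀ := by
      intro i
      induction i with
      | zero => exact fun hi => Finset.sum_congr rfl fun q _ => hcongr hi q _ _ (by simp)
      | succ i ih =>
        intro hi
        rw [← ih (by omega), ← sum_fiber_backwardValue hprrefl hprstep (hcongr hi) astar]
        exact Finset.sum_congr rfl fun q _ => (hgreedystep i hi q).symm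
    rw [← eq_zero (n - 1) le_rfl, Finset.sum_comm]
    refine Finset.sum_congr rfl fun o _ => ?_
    rw [hgreedytop, update_profile_eq_self hprrefl]
  refine ⟨value_greedy, ⟨astar, rfl⟩, ?_⟩
  rintro _ ⟨a, rfl⟩
  exact (value_le a).trans_eq value_greedy.symm
end

section
/- Sufficiency of an information statistic (sufficient-statistic reduction): for a finite partially observed model equipped with a sufficient statistic (B, b_t, φ, ρ, ω), the maximum of the expected discounted return over all history-dependent policies equals its maximum over statistic-based policies, i.e. max over all policies π of J(π) = max over policies of the form π_t = ψ_t ∘ b_t (for maps ψ_t : B → U) of J(π). -/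
open scoped Classical

namespace DecPOMDP

variable {X U Z : Type}

/-- Auxiliary filter, recursing on the (reversed) history. -/
noncomputable def filtAux [Fintype X] (s0 : X → ℝ) (p : X → U → X → Z → ℝ) :
    List (U × Z) → X → ℝ
  | [], x => s0 x
  | uz :: rest, y => ∑ x, filtAux s0 p rest x * p x uz.1 y uz.2

/-- The policy-independent unnormalized filter `μ`:
`filt s0 p [] = s0` and `filt s0 p (o ++ [(u,z)]) y = ∑ x, filt s0 p o x * p x u y z`. -/
noncomputable def filt [Fintype X] (s0 : X → ℝ) (p : X → U → X → Z → ℝ)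
    (o : List (U × Z)) (x : X) : ℝ :=
  filtAux s0 p o.reverse x

/-- A history is reachable if its total filter mass is positive. -/
def reachable [Fintype X] (s0 : X → ℝ) (p : X → U → X → Z → ℝ)
    (o : List (U × Z)) : Prop :=
  0 < ∑ x, filt s0 p o x

/-- The belief (normalized filter) of a history. -/
noncomputable def bel [Fintype X] (s0 : X → ℝ) (p : X → U → X → Z → ℝ)
    (o : List (U × Z)) (x : X) : ℝ :=
  filt s0 p o x / ∑ x', filt s0 p o x'

/-- Optimal history value with `k` stages to go: `Vstar s0 p r γ (ℓ - t)` is `V*_t`. -/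
noncomputable def Vstar [Fintype X] [Fintype U] [Fintype Z] [Nonempty U]
    (s0 : X → ℝ) (p : X → U → X → Z → ℝ) (r : X → U → ℝ) (γ : ℝ) :
    ℕ → List (U × Z) → ℝ
  | 0, _ => 0
  | k + 1, o =>
    Finset.univ.sup' Finset.univ_nonempty fun u : U =>
      (∑ x, bel s0 p o x * r x u) +
        γ * ∑ z : Z,
          if reachable s0 p (o ++ [(u, z)]) then
            (∑ x, ∑ y, bel s0 p o x * p x u y z) * Vstar s0 p r γ k (o ++ [(u, z)])
          else 0

/-- Optimal history action-value: `Qstar s0 p r γ (ℓ - t - 1)` is `Q*_t` (for `t < ℓ`). -/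
noncomputable def Qstar [Fintype X] [Fintype U] [Fintype Z] [Nonempty U]
    (s0 : X → ℝ) (p : X → U → X → Z → ℝ) (r : X → U → ℝ) (γ : ℝ)
    (k : ℕ) (o : List (U × Z)) (u : U) : ℝ :=
  (∑ x, bel s0 p o x * r x u) +
    γ * ∑ z : Z,
      if reachable s0 p (o ++ [(u, z)]) then
        (∑ x, ∑ y, bel s0 p o x * p x u y z) * Vstar s0 p r γ k (o ++ [(u, z)])
      else 0

/-- The history generated up to stage `t` by policy `π` along observation stream `z`
(`z t` being the observation received at stage `t+1`). -/
def hist (π : List (U × Z) → U) (z : ℕ → Z) : ℕ → List (U × Z)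
  | 0 => []
  | t + 1 => hist π z t ++ [(π (hist π z t), z t)]

/-- Extend a finitely indexed stream to `ℕ` (junk beyond `m`). -/
noncomputable def extend {α : Type} [Nonempty α] (m : ℕ) (f : Fin m → α) (t : ℕ) : α :=
  if h : t < m then f ⟨t, h⟩ else Classical.arbitrary α

/-- Expected discounted return `J(π)`: a finite sum over trajectories
`(x_0, …, x_ℓ, z_1, …, z_ℓ)` of the trajectory probability times the discounted return,
actions being chosen by `π` on the generated histories. -/
noncomputable def Jret [Fintype X] [Fintype U] [Fintype Z] [Nonempty X] [Nonempty Z]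
    (s0 : X → ℝ) (p : X → U → X → Z → ℝ) (r : X → U → ℝ) (γ : ℝ) (ℓ : ℕ)
    (π : List (U × Z) → U) : ℝ :=
  ∑ x : Fin (ℓ + 1) → X, ∑ z : Fin ℓ → Z,
    (s0 (extend (ℓ + 1) x 0) *
        ∏ t ∈ Finset.range ℓ,
          p (extend (ℓ + 1) x t) (π (hist π (extend ℓ z) t))
            (extend (ℓ + 1) x (t + 1)) (extend ℓ z t)) *
      ∑ t ∈ Finset.range ℓ, γ ^ t * r (extend (ℓ + 1) x t) (π (hist π (extend ℓ z) t))

/-- `Pr_π(o_t = o ∧ x_t = xh)`: a finite sum over partial trajectories. -/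
noncomputable def PrHS [Fintype X] [Fintype U] [Fintype Z] [Nonempty X] [Nonempty Z]
    (s0 : X → ℝ) (p : X → U → X → Z → ℝ) (π : List (U × Z) → U)
    (t : ℕ) (o : List (U × Z)) (xh : X) : ℝ :=
  ∑ x : Fin (t + 1) → X, ∑ z : Fin t → Z,
    if hist π (extend t z) t = o ∧ extend (t + 1) x t = xh then
      s0 (extend (t + 1) x 0) *
        ∏ s ∈ Finset.range t,
          p (extend (t + 1) x s) (π (hist π (extend t z) s))
            (extend (t + 1) x (s + 1)) (extend t z s)
    else 0

/-- `Pr_π(o_t = o)`. -/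
noncomputable def PrH [Fintype X] [Fintype U] [Fintype Z] [Nonempty X] [Nonempty Z]
    (s0 : X → ℝ) (p : X → U → X → Z → ℝ) (π : List (U × Z) → U)
    (t : ℕ) (o : List (U × Z)) : ℝ :=
  ∑ xh, PrHS s0 p π t o xh

end DecPOMDP

namespace DecPOMDP

section Trajectories

variable {X U Z : Type}

theorem extend_cons_zero {α : Type} [Nonempty α] (m : ℕ) (a : α) (f : Fin m → α) :
    extend (m + 1) (Fin.cons a f : Fin (m + 1) → α) 0 = a := by
  simp [extend]

theorem extend_cons_succ {α : Type} [Nonempty α] (m : ℕ) (a : α) (f : Fin m → α) (t : ℕ) :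
    extend (m + 1) (Fin.cons a f : Fin (m + 1) → α) (t + 1) = extend m f t := by
  by_cases h : t < m
  · rw [extend, dif_pos (Nat.succ_lt_succ h), extend, dif_pos h]
    rfl
  · simp [extend, h]

theorem hist_zero (π : List (U × Z) → U) (z : ℕ → Z) : hist π z 0 = [] := rfl

theorem hist_succ_eq_cons (π : List (U × Z) → U) (z : ℕ → Z) (t : ℕ) :
    hist π z (t + 1) =
      (π [], z 0) :: hist (fun o => π ((π [], z 0) :: o)) (fun s => z (s + 1)) t := by
  induction t with
  | zero => rfl
  | succ t ih =>
    rw [hist, ih]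
    simp [hist]

theorem sum_pi_fin_succ {α : Type} [Fintype α] (m : ℕ) (F : (Fin (m + 1) → α) → ℝ) :
    ∑ f, F f = ∑ a, ∑ g : Fin m → α, F (Fin.cons a g) := by
  rw [← Fintype.sum_prod_type', ← (Fin.consEquiv fun _ => α).sum_comp]
  rfl

variable [Nonempty X] [Nonempty Z]

/-- The unnormalized probability of a trajectory under the policy `π`, with initial weight `s`. -/
noncomputable def trajWeight (s : X → ℝ) (p : X → U → X → Z → ℝ) (n : ℕ)
    (π : List (U × Z) → U) (x : Fin (n + 1) → X) (z : Fin n → Z) : ℝ :=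
  s (extend (n + 1) x 0) *
    ∏ t ∈ Finset.range n,
      p (extend (n + 1) x t) (π (hist π (extend n z) t))
        (extend (n + 1) x (t + 1)) (extend n z t)

/-- The discounted return collected along a trajectory under the policy `π`. -/
noncomputable def trajReturn (r : X → U → ℝ) (γ : ℝ) (n : ℕ)
    (π : List (U × Z) → U) (x : Fin (n + 1) → X) (z : Fin n → Z) : ℝ :=
  ∑ t ∈ Finset.range n, γ ^ t * r (extend (n + 1) x t) (π (hist π (extend n z) t))

theorem hist_extend_cons (π : List (U × Z) → U) (n : ℕ) (c : Z) (z : Fin n → Z) (t : ℕ) :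
    hist π (extend (n + 1) (Fin.cons c z : Fin (n + 1) → Z)) (t + 1) =
      (π [], c) :: hist (fun o => π ((π [], c) :: o)) (extend n z) t := by
  rw [hist_succ_eq_cons]
  simp only [extend_cons_zero, extend_cons_succ]

theorem trajWeight_cons (s : X → ℝ) (p : X → U → X → Z → ℝ) (n : ℕ)
    (π : List (U × Z) → U) (a : X) (x : Fin (n + 1) → X) (c : Z) (z : Fin n → Z) :
    trajWeight s p (n + 1) π (Fin.cons a x) (Fin.cons c z) =
      s a * trajWeight (fun y => p a (π []) y c) p n (fun o => π ((π [], c) :: o)) x z := by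
  simp only [trajWeight, Finset.prod_range_succ', hist_extend_cons, extend_cons_succ,
    extend_cons_zero, hist_zero]
  ring

theorem trajReturn_cons (r : X → U → ℝ) (γ : ℝ) (n : ℕ)
    (π : List (U × Z) → U) (a : X) (x : Fin (n + 1) → X) (c : Z) (z : Fin n → Z) :
    trajReturn r γ (n + 1) π (Fin.cons a x) (Fin.cons c z) =
      r a (π []) + γ * trajReturn r γ n (fun o => π ((π [], c) :: o)) x z := by
  simp only [trajReturn, Finset.sum_range_succ', hist_extend_cons, extend_cons_succ,
    extend_cons_zero, hist_zero, Finset.mul_sum]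
  rw [add_comm]
  congr 1
  · simp
  · exact Finset.sum_congr rfl fun t _ => by ring

theorem sum_mul_trajWeight [Fintype X] (q : X → X → ℝ) (s : X → ℝ) (p : X → U → X → Z → ℝ) (n : ℕ)
    (π : List (U × Z) → U) (x : Fin (n + 1) → X) (z : Fin n → Z) :
    ∑ a, s a * trajWeight (q a) p n π x z =
      trajWeight (fun y => ∑ a, s a * q a y) p n π x z := by
  simp only [trajWeight, Finset.sum_mul, mul_assoc]

variable [Fintype X] [Fintype Z]

theorem sum_trajWeight (p : X → U → X → Z → ℝ) (hpsum : ∀ x u, ∑ y, ∑ z, p x u y z = 1)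
    (n : ℕ) (s : X → ℝ) (π : List (U × Z) → U) :
    ∑ x : Fin (n + 1) → X, ∑ z : Fin n → Z, trajWeight s p n π x z = ∑ a, s a := by
  induction n generalizing s π with
  | zero =>
    rw [sum_pi_fin_succ]
    simp [trajWeight, extend_cons_zero]
  | succ n ih =>
    calc ∑ x, ∑ z, trajWeight s p (n + 1) π x z
        = ∑ a, ∑ x, ∑ c, ∑ z, trajWeight s p (n + 1) π (Fin.cons a x) (Fin.cons c z) := by
          simp only [sum_pi_fin_succ (n + 1), sum_pi_fin_succ n fun z => trajWeight _ _ _ _ _ z]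
      _ = ∑ a, s a * ∑ c, ∑ x, ∑ z,
            trajWeight (fun y => p a (π []) y c) p n (fun o => π ((π [], c) :: o)) x z := by
          refine Finset.sum_congr rfl fun a _ => ?_
          rw [Finset.sum_comm]
          simp only [trajWeight_cons, Finset.mul_sum]
      _ = ∑ a, s a := by
          refine Finset.sum_congr rfl fun a _ => ?_
          simp only [ih]
          rw [Finset.sum_comm, hpsum, mul_one]

variable [Fintype U]

theorem Jret_eq_sum_traj (s : X → ℝ) (p : X → U → X → Z → ℝ) (r : X → U → ℝ) (γ : ℝ) (n : ℕ)
    (π : List (U × Z) → U) :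
    Jret s p r γ n π = ∑ x, ∑ z, trajWeight s p n π x z * trajReturn r γ n π x z := rfl

/-- Dynamic programming recursion for the return of a fixed policy, by conditioning on the
first stage. -/
theorem Jret_succ (p : X → U → X → Z → ℝ) (hpsum : ∀ x u, ∑ y, ∑ z, p x u y z = 1)
    (s : X → ℝ) (r : X → U → ℝ) (γ : ℝ) (n : ℕ) (π : List (U × Z) → U) :
    Jret s p r γ (n + 1) π =
      ∑ a, s a * r a (π []) +
        γ * ∑ c, Jret (fun y => ∑ a, s a * p a (π []) y c) p r γ n
          (fun o => π ((π [], c) :: o)) := by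
  have hfirst : ∀ a, ∑ c, ∑ x, ∑ z,
      trajWeight (fun y => p a (π []) y c) p n (fun o => π ((π [], c) :: o)) x z = 1 := by
    intro a
    simp only [sum_trajWeight p hpsum]
    rw [Finset.sum_comm, hpsum]
  have hrest : ∀ c, Jret (fun y => ∑ a, s a * p a (π []) y c) p r γ n
      (fun o => π ((π [], c) :: o)) =
      ∑ a, s a * ∑ x, ∑ z,
        trajWeight (fun y => p a (π []) y c) p n (fun o => π ((π [], c) :: o)) x z *
          trajReturn r γ n (fun o => π ((π [], c) :: o)) x z := by
    intro c
    simp only [Jret_eq_sum_traj, ← sum_mul_trajWeight (fun a y => p a (π []) y c),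
      Finset.sum_mul, Finset.mul_sum, mul_assoc]
    symm
    rw [Finset.sum_comm]
    exact Finset.sum_congr rfl fun x _ => Finset.sum_comm
  calc Jret s p r γ (n + 1) π
      = ∑ a, ∑ x, ∑ c, ∑ z,
          trajWeight s p (n + 1) π (Fin.cons a x) (Fin.cons c z) *
            trajReturn r γ (n + 1) π (Fin.cons a x) (Fin.cons c z) := by
        rw [Jret_eq_sum_traj]
        simp only [sum_pi_fin_succ (n + 1),
          sum_pi_fin_succ n fun z => trajWeight _ _ _ _ _ z * trajReturn _ _ _ _ _ z]
    _ = ∑ a, (s a * r a (π []) * (∑ c, ∑ x, ∑ z,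
            trajWeight (fun y => p a (π []) y c) p n (fun o => π ((π [], c) :: o)) x z) +
          γ * ∑ c, s a * ∑ x, ∑ z,
            trajWeight (fun y => p a (π []) y c) p n (fun o => π ((π [], c) :: o)) x z *
              trajReturn r γ n (fun o => π ((π [], c) :: o)) x z) := by
        refine Finset.sum_congr rfl fun a _ => ?_
        rw [Finset.sum_comm]
        simp only [trajWeight_cons, trajReturn_cons, Finset.mul_sum, ← Finset.sum_add_distrib]
        refine Finset.sum_congr rfl fun c _ => Finset.sum_congr rfl fun x _ =>
          Finset.sum_congr rfl fun z _ => ?_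
        ring
    _ = _ := by
        rw [Finset.sum_congr rfl fun c _ => hrest c, Finset.sum_comm]
        simp only [hfirst, mul_one, Finset.sum_add_distrib, ← Finset.mul_sum]

end Trajectories

section Filter

variable {X U Z : Type} [Fintype X]

theorem filt_append_singleton (s0 : X → ℝ) (p : X → U → X → Z → ℝ)
    (o : List (U × Z)) (u : U) (z : Z) :
    filt s0 p (o ++ [(u, z)]) = fun y => ∑ x, filt s0 p o x * p x u y z := by
  funext y
  simp [filt, filtAux]

theorem filt_nonneg {s0 : X → ℝ} (hs0 : ∀ x, 0 ≤ s0 x) {p : X → U → X → Z → ℝ}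
    (hp : ∀ x u y z, 0 ≤ p x u y z) (o : List (U × Z)) (x : X) : 0 ≤ filt s0 p o x := by
  induction o using List.reverseRecOn generalizing x with
  | nil => exact hs0 x
  | append_singleton o uz ih =>
    rw [filt_append_singleton]
    exact Finset.sum_nonneg fun a _ => mul_nonneg (ih a) (hp _ _ _ _)

theorem sum_filt_eq_zero_of_not_reachable {s0 : X → ℝ} (hs0 : ∀ x, 0 ≤ s0 x)
    {p : X → U → X → Z → ℝ} (hp : ∀ x u y z, 0 ≤ p x u y z) {o : List (U × Z)}
    (ho : ¬ reachable s0 p o) : ∑ x, filt s0 p o x = 0 :=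
  le_antisymm (not_lt.mp ho) (Finset.sum_nonneg fun x _ => filt_nonneg hs0 hp o x)

theorem filt_eq_mass_mul_bel {s0 : X → ℝ} {p : X → U → X → Z → ℝ} {o : List (U × Z)}
    (ho : reachable s0 p o) (x : X) :
    filt s0 p o x = (∑ x', filt s0 p o x') * bel s0 p o x :=
  (mul_div_cancel₀ _ (ne_of_gt ho)).symm

end Filter

section Statistic

variable {X U Z B : Type} [Fintype Z]

/-- Optimal value of a statistic with `k` stages to go. -/
noncomputable def statValue (φ : B → U → Z → B) (ρ : B → U → ℝ) (ω : B → U → Z → ℝ) (γ : ℝ) :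
    ℕ → B → ℝ
  | 0, _ => 0
  | k + 1, b => ⨆ u, (ρ b u + γ * ∑ z, ω b u z * statValue φ ρ ω γ k (φ b u z))

/-- Action-value of a statistic with `k` stages to go after the action. -/
noncomputable def statActionValue (φ : B → U → Z → B) (ρ : B → U → ℝ) (ω : B → U → Z → ℝ)
    (γ : ℝ) (k : ℕ) (b : B) (u : U) : ℝ :=
  ρ b u + γ * ∑ z, ω b u z * statValue φ ρ ω γ k (φ b u z)

theorem exists_greedy [Finite U] [Nonempty U] (φ : B → U → Z → B) (ρ : B → U → ℝ)
    (ω : B → U → Z → ℝ) (γ : ℝ) :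
    ∃ g : ℕ → B → U, ∀ k b,
      statActionValue φ ρ ω γ k b (g k b) = statValue φ ρ ω γ (k + 1) b := by
  have h : ∀ k b, ∃ u, statActionValue φ ρ ω γ k b u = statValue φ ρ ω γ (k + 1) b :=
    fun k b => exists_eq_ciSup_of_finite
  choose g hg using h
  exact ⟨g, hg⟩

theorem statActionValue_le [Finite U] (φ : B → U → Z → B) (ρ : B → U → ℝ)
    (ω : B → U → Z → ℝ) (γ : ℝ) (k : ℕ) (b : B) (u : U) :
    statActionValue φ ρ ω γ k b u ≤ statValue φ ρ ω γ (k + 1) b :=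
  Finite.le_ciSup (fun u => statActionValue φ ρ ω γ k b u) u

/-- A sufficient statistic computes the one-stage lookahead of the filter. -/
theorem lookahead_eq_mass_mul_statActionValue [Fintype X]
    {s0 : X → ℝ} (hs0 : ∀ x, 0 ≤ s0 x) {p : X → U → X → Z → ℝ} (hp : ∀ x u y z, 0 ≤ p x u y z)
    (r : X → U → ℝ) (γ : ℝ) (bstat : List (U × Z) → B)
    (φ : B → U → Z → B) (ρ : B → U → ℝ) (ω : B → U → Z → ℝ)
    {o : List (U × Z)} (ho : reachable s0 p o) (u : U)
    (hρ : ∑ x, bel s0 p o x * r x u = ρ (bstat o) u)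
    (hω : ∀ z, ∑ x, ∑ y, bel s0 p o x * p x u y z = ω (bstat o) u z)
    (hφ : ∀ z, reachable s0 p (o ++ [(u, z)]) → bstat (o ++ [(u, z)]) = φ (bstat o) u z)
    (k : ℕ) :
    ∑ x, filt s0 p o x * r x u +
        γ * ∑ z, (∑ y, filt s0 p (o ++ [(u, z)]) y) *
          statValue φ ρ ω γ k (bstat (o ++ [(u, z)])) =
      (∑ x, filt s0 p o x) * statActionValue φ ρ ω γ k (bstat o) u := by
  have hmass : ∀ z, ∑ y, filt s0 p (o ++ [(u, z)]) y =
      (∑ x, filt s0 p o x) * ω (bstat o) u z := by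
    intro z
    rw [filt_append_singleton, Finset.sum_comm, ← hω, Finset.mul_sum]
    refine Finset.sum_congr rfl fun x _ => ?_
    rw [Finset.mul_sum]
    refine Finset.sum_congr rfl fun y _ => ?_
    rw [← mul_assoc, ← filt_eq_mass_mul_bel ho]
  have hreward : ∑ x, filt s0 p o x * r x u = (∑ x, filt s0 p o x) * ρ (bstat o) u := by
    rw [← hρ, Finset.mul_sum]
    refine Finset.sum_congr rfl fun x _ => ?_
    rw [← mul_assoc, ← filt_eq_mass_mul_bel ho]
  have hnext : ∀ z, (∑ y, filt s0 p (o ++ [(u, z)]) y) *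
      statValue φ ρ ω γ k (bstat (o ++ [(u, z)])) =
      (∑ x, filt s0 p o x) * (ω (bstat o) u z * statValue φ ρ ω γ k (φ (bstat o) u z)) := by
    intro z
    rw [← mul_assoc, ← hmass]
    by_cases hz : reachable s0 p (o ++ [(u, z)])
    · rw [hφ z hz]
    · rw [sum_filt_eq_zero_of_not_reachable hs0 hp hz, zero_mul, zero_mul]
  simp only [hnext, hreward, ← Finset.mul_sum, statActionValue]
  ring

theorem Jret_eq_zero_of_not_reachable [Fintype X] [Fintype U] [Nonempty X] [Nonempty Z]
    {s0 : X → ℝ} (hs0 : ∀ x, 0 ≤ s0 x) {p : X → U → X → Z → ℝ} (hp : ∀ x u y z, 0 ≤ p x u y z)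
    (r : X → U → ℝ) (γ : ℝ) (k : ℕ) {o : List (U × Z)} (ho : ¬ reachable s0 p o)
    (π : List (U × Z) → U) : Jret (filt s0 p o) p r γ k π = 0 := by
  have h0 : ∀ x, filt s0 p o x = 0 := fun x =>
    (Finset.sum_eq_zero_iff_of_nonneg fun x _ => filt_nonneg hs0 hp o x).mp
      (sum_filt_eq_zero_of_not_reachable hs0 hp ho) x (Finset.mem_univ x)
  simp [Jret, h0]

end Statistic

end DecPOMDP

open DecPOMDP in
/-- Sufficiency of an information statistic: the maximum expected discounted return over
all history-dependent policies exists and equals the maximum over statistic-based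
policies `π_t = ψ_t ∘ b_t`. -/
theorem stmt3 (X U Z : Type) [Fintype X] [Nonempty X] [Fintype U] [Nonempty U]
    [Fintype Z] [Nonempty Z]
    (s0 : X → ℝ) (hs0 : ∀ x, 0 ≤ s0 x) (hs0sum : ∑ x, s0 x = 1)
    (p : X → U → X → Z → ℝ) (hp : ∀ x u y z, 0 ≤ p x u y z)
    (hpsum : ∀ x u, ∑ y, ∑ z, p x u y z = 1)
    (r : X → U → ℝ) (γ : ℝ) (hγ0 : 0 ≤ γ) (hγ1 : γ ≤ 1) (ℓ : ℕ)
    (B : Type) (bstat : List (U × Z) → B)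
    (φ : B → U → Z → B) (ρ : B → U → ℝ) (ω : B → U → Z → ℝ)
    (hρ : ∀ o : List (U × Z), o.length < ℓ → reachable s0 p o →
      ∀ u, ∑ x, bel s0 p o x * r x u = ρ (bstat o) u)
    (hω : ∀ o : List (U × Z), o.length < ℓ → reachable s0 p o →
      ∀ u z, ∑ x, ∑ y, bel s0 p o x * p x u y z = ω (bstat o) u z)
    (hφ : ∀ o : List (U × Z), o.length < ℓ → reachable s0 p o →
      ∀ u z, reachable s0 p (o ++ [(u, z)]) →
        bstat (o ++ [(u, z)]) = φ (bstat o) u z) :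
    ∃ m : ℝ,
      IsGreatest {val : ℝ | ∃ π : List (U × Z) → U, val = Jret s0 p r γ ℓ π} m ∧
      IsGreatest {val : ℝ | ∃ π : List (U × Z) → U,
        (∃ ψ : ℕ → B → U, ∀ o : List (U × Z), π o = ψ o.length (bstat o)) ∧
        val = Jret s0 p r γ ℓ π} m := by
  have hstep := fun (o : List (U × Z)) (hlen : o.length < ℓ) (ho : reachable s0 p o) (u : U) =>
    lookahead_eq_mass_mul_statActionValue hs0 hp r γ bstat φ ρ ω ho u
      (hρ o hlen ho u) (hω o hlen ho u) (hφ o hlen ho u)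
  have hrec : ∀ (k : ℕ) (o : List (U × Z)) (π : List (U × Z) → U),
      Jret (filt s0 p o) p r γ (k + 1) (fun o' => π (o ++ o')) =
        ∑ x, filt s0 p o x * r x (π o) +
          γ * ∑ z, Jret (filt s0 p (o ++ [(π o, z)])) p r γ k
            (fun o' => π ((o ++ [(π o, z)]) ++ o')) := by
    intro k o π
    rw [Jret_succ p hpsum]
    simp only [List.append_nil, filt_append_singleton, List.append_assoc, List.singleton_append]
  have hle : ∀ (π : List (U × Z) → U) (k : ℕ) (o : List (U × Z)), o.length + k = ℓ →
      Jret (filt s0 p o) p r γ k (fun o' => π (o ++ o')) ≤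
        (∑ x, filt s0 p o x) * statValue φ ρ ω γ k (bstat o) := by
    intro π k
    induction k with
    | zero => intro o _; simp [Jret, statValue]
    | succ k ih =>
      intro o hlen
      by_cases ho : reachable s0 p o
      · calc _ ≤ ∑ x, filt s0 p o x * r x (π o) +
              γ * ∑ z, (∑ y, filt s0 p (o ++ [(π o, z)]) y) *
                statValue φ ρ ω γ k (bstat (o ++ [(π o, z)])) := by
              rw [hrec]
              gcongr with z
              exact ih _ (by simp; omega)
          _ = _ := hstep o (by omega) ho (π o) k
          _ ≤ _ := mul_le_mul_of_nonneg_left (statActionValue_le φ ρ ω γ k _ _) ho.le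
      · rw [Jret_eq_zero_of_not_reachable hs0 hp r γ _ ho,
          sum_filt_eq_zero_of_not_reachable hs0 hp ho, zero_mul]
  obtain ⟨g, hg⟩ := exists_greedy φ ρ ω γ
  let πg : List (U × Z) → U := fun o => g (ℓ - o.length - 1) (bstat o)
  have heq : ∀ (k : ℕ) (o : List (U × Z)), o.length + k = ℓ →
      Jret (filt s0 p o) p r γ k (fun o' => πg (o ++ o')) =
        (∑ x, filt s0 p o x) * statValue φ ρ ω γ k (bstat o) := by
    intro k
    induction k with
    | zero => intro o _; simp [Jret, statValue]
    | succ k ih =>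
      intro o hlen
      by_cases ho : reachable s0 p o
      · have hgo : πg o = g k (bstat o) := by
          simp only [πg]
          congr 1
          omega
        rw [hrec, ← hg, ← hgo, ← hstep o (by omega) ho (πg o) k]
        congr 2
        exact Finset.sum_congr rfl fun z _ => ih _ (by simp; omega)
      · rw [Jret_eq_zero_of_not_reachable hs0 hp r γ _ ho,
          sum_filt_eq_zero_of_not_reachable hs0 hp ho, zero_mul]
  have hopt : ∀ π : List (U × Z) → U, Jret s0 p r γ ℓ π ≤ Jret s0 p r γ ℓ πg := fun π =>
    (hle π ℓ [] (by simp)).trans_eq (heq ℓ [] (by simp)).symm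
  refine ⟨Jret s0 p r γ ℓ πg, ⟨⟨πg, rfl⟩, ?_⟩,
    ⟨⟨πg, ⟨fun t b => g (ℓ - t - 1) b, fun _ => rfl⟩, rfl⟩, ?_⟩⟩
  · rintro _ ⟨π, rfl⟩
    exact hopt π
  · rintro _ ⟨π, -, rfl⟩
    exact hopt π
end

section
/- α-vector representation of the finite-horizon value recursion: for every τ ≤ ℓ there is a finite nonempty set Γ_τ of vectors α : Y_τ → ℝ such that V_τ(s) = max_{α∈Γ_τ} ⟨α, s⟩ for every s : Y_τ → ℝ. Moreover, the sets may be constructed recursively by Γ_ℓ = {0} and Γ_τ = { r_{τ,a} + γ·∑_{z∈Z} L_{τ,a,z}·α_z : a ∈ A, (α_z)_{z∈Z} a family of elements of Γ_{τ+1} }, where (L·α)(y) := ∑_{y'} L(y,y')·α(y'). In particular each V_τ is piecewise-linear, positively homogeneous, and convex. -/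
/-- Finite-horizon linear-branching value recursion: `Vrec L r γ k τ s` is the value at
stage `τ` with `k` stages to go, so `V_τ = Vrec L r γ (ℓ - τ) τ` for horizon `ℓ`. -/
noncomputable def Vrec {Y : ℕ → Type} [∀ τ, Fintype (Y τ)] {A Z : Type}
    [Fintype A] [Nonempty A] [Fintype Z]
    (L : (τ : ℕ) → A → Z → Y τ → Y (τ + 1) → ℝ)
    (r : (τ : ℕ) → A → Y τ → ℝ) (γ : ℝ) : (k : ℕ) → (τ : ℕ) → (Y τ → ℝ) → ℝ
  | 0, _, _ => 0
  | k + 1, τ, s =>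
    Finset.univ.sup' Finset.univ_nonempty fun a : A =>
      (∑ y, r τ a y * s y) +
        γ * ∑ z : Z, Vrec L r γ k (τ + 1) (fun y' => ∑ y, s y * L τ a z y y')

section AlphaVectors

variable {Y : ℕ → Type} [∀ τ, Fintype (Y τ)] {A Z : Type} [Fintype Z]
  (L : (τ : ℕ) → A → Z → Y τ → Y (τ + 1) → ℝ) (r : (τ : ℕ) → A → Y τ → ℝ) (γ : ℝ)

/-- The Bellman backup of a family `α` of vectors at stage `τ + 1` under the action `a`. -/
def alphaBackup (τ : ℕ) (a : A) (α : Z → Y (τ + 1) → ℝ) : Y τ → ℝ :=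
  fun y => r τ a y + γ * ∑ z, ∑ y', L τ a z y y' * α z y'

theorem sum_alphaBackup_mul (τ : ℕ) (a : A) (α : Z → Y (τ + 1) → ℝ) (s : Y τ → ℝ) :
    ∑ y, alphaBackup L r γ τ a α y * s y =
      (∑ y, r τ a y * s y) + γ * ∑ z, ∑ y', α z y' * ∑ y, s y * L τ a z y y' := by
  simp only [alphaBackup, add_mul, Finset.sum_add_distrib, Finset.mul_sum, Finset.sum_mul]
  congr 1
  rw [Finset.sum_comm]
  refine Finset.sum_congr rfl fun z _ => ?_
  rw [Finset.sum_comm]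
  refine Finset.sum_congr rfl fun y' _ => Finset.sum_congr rfl fun y _ => ?_
  ring

variable [Fintype A]

open Classical in
/-- The α-vectors at stage `τ` with `k` stages to go. -/
noncomputable def alphaVectors : (k : ℕ) → (τ : ℕ) → Finset (Y τ → ℝ)
  | 0, _ => {0}
  | k + 1, τ =>
    (Finset.univ ×ˢ Fintype.piFinset fun _ : Z => alphaVectors k (τ + 1)).image
      fun p : A × (Z → Y (τ + 1) → ℝ) => alphaBackup L r γ τ p.1 p.2

theorem mem_alphaVectors_succ {k τ : ℕ} {g : Y τ → ℝ} :
    g ∈ alphaVectors L r γ (k + 1) τ ↔ ∃ (a : A) (α : Z → Y (τ + 1) → ℝ),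
      (∀ z, α z ∈ alphaVectors L r γ k (τ + 1)) ∧ g = alphaBackup L r γ τ a α := by
  simp [alphaVectors, eq_comm]

variable [Nonempty A]

theorem alphaVectors_nonempty (k τ : ℕ) : (alphaVectors L r γ k τ).Nonempty := by
  induction k generalizing τ with
  | zero => simp [alphaVectors]
  | succ k ih =>
    obtain ⟨α, hα⟩ := ih (τ + 1)
    exact ⟨_, (mem_alphaVectors_succ L r γ).2
      ⟨Classical.arbitrary A, fun _ => α, fun _ => hα, rfl⟩⟩

variable {γ}

theorem sum_mul_le_Vrec (hγ : 0 ≤ γ) {k τ : ℕ} {α : Y τ → ℝ}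
    (hα : α ∈ alphaVectors L r γ k τ) (s : Y τ → ℝ) :
    ∑ y, α y * s y ≤ Vrec L r γ k τ s := by
  induction k generalizing τ with
  | zero =>
    obtain rfl : α = 0 := by simpa [alphaVectors] using hα
    simp [Vrec]
  | succ k ih =>
    obtain ⟨a, β, hβ, rfl⟩ := (mem_alphaVectors_succ L r γ).1 hα
    rw [sum_alphaBackup_mul, Vrec]
    refine le_trans ?_ (Finset.le_sup' _ (Finset.mem_univ a))
    gcongr with z
    exact ih (hβ z) _

variable (γ) in
theorem exists_mem_alphaVectors_Vrec_eq (k τ : ℕ) (s : Y τ → ℝ) :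
    ∃ α ∈ alphaVectors L r γ k τ, Vrec L r γ k τ s = ∑ y, α y * s y := by
  induction k generalizing τ with
  | zero => exact ⟨0, by simp [alphaVectors], by simp [Vrec]⟩
  | succ k ih =>
    rw [Vrec]
    obtain ⟨a, -, ha⟩ := Finset.exists_mem_eq_sup' (Finset.univ_nonempty (α := A)) fun a =>
      (∑ y, r τ a y * s y) +
        γ * ∑ z : Z, Vrec L r γ k (τ + 1) (fun y' => ∑ y, s y * L τ a z y y')
    choose α hα hV using fun z : Z => ih (τ + 1) (fun y' => ∑ y, s y * L τ a z y y')
    refine ⟨_, (mem_alphaVectors_succ L r γ).2 ⟨a, α, hα, rfl⟩, ?_⟩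
    rw [ha, sum_alphaBackup_mul]
    simp only [hV]

theorem Vrec_eq_sup'_alphaVectors (hγ : 0 ≤ γ) (k τ : ℕ) (s : Y τ → ℝ) :
    Vrec L r γ k τ s = (alphaVectors L r γ k τ).sup' (alphaVectors_nonempty L r γ k τ)
      fun α => ∑ y, α y * s y := by
  apply le_antisymm
  · obtain ⟨α, hα, hV⟩ := exists_mem_alphaVectors_Vrec_eq L r γ k τ s
    exact hV.trans_le (Finset.le_sup' (fun α : Y τ → ℝ => ∑ y, α y * s y) hα)
  · exact Finset.sup'_le _ _ fun α hα => sum_mul_le_Vrec L r hγ hα s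

theorem Vrec_smul (hγ : 0 ≤ γ) (k τ : ℕ) {c : ℝ} (hc : 0 ≤ c) (s : Y τ → ℝ) :
    Vrec L r γ k τ (c • s) = c * Vrec L r γ k τ s := by
  have hsmul (α : Y τ → ℝ) : ∑ y, α y * (c • s) y = c * ∑ y, α y * s y := by
    simp [Finset.mul_sum, mul_left_comm]
  apply le_antisymm
  · obtain ⟨α, hα, hV⟩ := exists_mem_alphaVectors_Vrec_eq L r γ k τ (c • s)
    rw [hV, hsmul]
    exact mul_le_mul_of_nonneg_left (sum_mul_le_Vrec L r hγ hα s) hc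
  · obtain ⟨α, hα, hV⟩ := exists_mem_alphaVectors_Vrec_eq L r γ k τ s
    rw [hV, ← hsmul]
    exact sum_mul_le_Vrec L r hγ hα _

theorem convexOn_Vrec (hγ : 0 ≤ γ) (k τ : ℕ) :
    ConvexOn ℝ Set.univ (Vrec L r γ k τ) := by
  refine ⟨convex_univ, fun s _ t _ b c hb hc _ => ?_⟩
  obtain ⟨α, hα, hV⟩ := exists_mem_alphaVectors_Vrec_eq L r γ k τ (b • s + c • t)
  have hlin : ∑ y, α y * (b • s + c • t) y =
      b * ∑ y, α y * s y + c * ∑ y, α y * t y := by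
    simp [Finset.mul_sum, mul_add, Finset.sum_add_distrib, mul_left_comm]
  rw [hV, hlin, smul_eq_mul, smul_eq_mul]
  gcongr
  · exact sum_mul_le_Vrec L r hγ hα s
  · exact sum_mul_le_Vrec L r hγ hα t

end AlphaVectors

theorem stmt7 (Y : ℕ → Type) [∀ τ, Fintype (Y τ)] [∀ τ, Nonempty (Y τ)]
    (A Z : Type) [Fintype A] [Nonempty A] [Fintype Z] [Nonempty Z]
    (ℓ : ℕ) (γ : ℝ) (hγ : 0 ≤ γ)
    (L : (τ : ℕ) → A → Z → Y τ → Y (τ + 1) → ℝ)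
    (r : (τ : ℕ) → A → Y τ → ℝ) :
    ∃ (Γ : (τ : ℕ) → Finset (Y τ → ℝ)) (hne : ∀ τ, (Γ τ).Nonempty),
      (∀ τ, τ ≤ ℓ → ∀ s : Y τ → ℝ,
        Vrec L r γ (ℓ - τ) τ s = (Γ τ).sup' (hne τ) fun α => ∑ y, α y * s y) ∧
      (Γ ℓ : Set (Y ℓ → ℝ)) = {0} ∧
      (∀ τ, τ < ℓ → (Γ τ : Set (Y τ → ℝ)) =
        {g | ∃ (a : A) (α : Z → Y (τ + 1) → ℝ), (∀ z, α z ∈ Γ (τ + 1)) ∧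
          g = fun y => r τ a y + γ * ∑ z : Z, ∑ y', L τ a z y y' * α z y'}) ∧
      (∀ τ, τ ≤ ℓ → ∀ (c : ℝ), 0 ≤ c → ∀ s : Y τ → ℝ,
        Vrec L r γ (ℓ - τ) τ (c • s) = c * Vrec L r γ (ℓ - τ) τ s) ∧
      (∀ τ, τ ≤ ℓ → ConvexOn ℝ Set.univ (Vrec L r γ (ℓ - τ) τ)) := by
  refine ⟨fun τ => alphaVectors L r γ (ℓ - τ) τ, fun τ => alphaVectors_nonempty L r γ _ τ,
    fun τ _ s => Vrec_eq_sup'_alphaVectors L r hγ _ τ s, by simp [alphaVectors], fun τ hτ => ?_,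
    fun τ _ c hc s => Vrec_smul L r hγ _ τ hc s, fun τ _ => convexOn_Vrec L r hγ _ τ⟩
  obtain ⟨k, hk⟩ : ∃ k, ℓ - τ = k + 1 := ⟨ℓ - τ - 1, by lia⟩
  obtain hk' : ℓ - (τ + 1) = k := by lia
  ext g
  simp only [hk, hk']
  exact mem_alphaVectors_succ L r γ
end
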